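/- arXiv:1503.00153 — 3 statements merged into one kernel-verified Lean document; each statement's English description precedes it below -/
import Mathlib

section
/- The breakdown/repair process is reversible with respect to π̂: for all subsets D, E ⊆ J̃ the detailed balance equation π̂(D)·q^Y(D,E) = π̂(E)·q^Y(E,D) holds. -/
open scoped BigOperators

noncomputable section

namespace UnrelNet

/-- State space of the unreliable Jackson network: a set of broken-down nodes
together with a queue-length vector. -/
abbrev Est (J : ℕ) := Finset (Fin J) × (Fin J → ℕ)

/-- The extended node set `J̃₀ ∖ D`: the exterior node `none` together with
the up nodes (complement of `D`). -/
def ext (J : ℕ) (D : Finset (Fin J)) : Finset (Option (Fin J)) :=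
  insert none (Dᶜ.image Option.some)

/-- Unit vector `e_j` of `ℕ^J̃`, with `e_0 = 0` (index `none`). -/
def eV {J : ℕ} (o : Option (Fin J)) : Fin J → ℕ := fun i =>
  match o with
  | none => 0
  | some j => if i = j then 1 else 0

/-- Breakdown/repair generator `Q^Y`. -/
def QY {J : ℕ} (A B : Finset (Fin J) → ℝ) (f : Finset (Fin J) → ℝ)
    (D : Finset (Fin J)) : ℝ :=
  (∑ H ∈ Finset.univ.filter (fun H => H ⊂ D), B D / B H * (f H - f D))
    + ∑ I ∈ Finset.univ.filter (fun I => D ⊂ I), A I / A D * (f I - f D)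

/-- Off-diagonal breakdown/repair rates. -/
def qY0 {J : ℕ} (A B : Finset (Fin J) → ℝ) (D E : Finset (Fin J)) : ℝ :=
  if D ⊂ E then A E / A D else if E ⊂ D then B D / B E else 0

/-- Breakdown/repair rate matrix `q^Y`, including the diagonal. -/
def qY {J : ℕ} (A B : Finset (Fin J) → ℝ) (D E : Finset (Fin J)) : ℝ :=
  if E = D then -∑ F, qY0 A B D F else qY0 A B D E

/-- Breakdown/repair generator written via the rate matrix. -/
def QYm {J : ℕ} (A B : Finset (Fin J) → ℝ) (f : Finset (Fin J) → ℝ)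
    (D : Finset (Fin J)) : ℝ :=
  ∑ E, qY A B D E * f E

/-- Normalisation constant `Ĉ`. -/
def Chat {J : ℕ} (A B : Finset (Fin J) → ℝ) : ℝ := ∑ D, A D / B D

/-- Stationary distribution `π̂` of the breakdown/repair process. -/
def piY {J : ℕ} (A B : Finset (Fin J) → ℝ) (D : Finset (Fin J)) : ℝ :=
  (A D / B D) / Chat A B

/-- `Π_{i=1}^{k} η_j/μ_j(i)`. -/
def prodK {J : ℕ} (η : Fin J → ℝ) (μ : Fin J → ℕ → ℝ) (j : Fin J) (k : ℕ) : ℝ :=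
  ∏ i ∈ Finset.range k, η j / μ j (i + 1)

/-- Normalisation constant `C_j`. -/
def Cnorm {J : ℕ} (η : Fin J → ℝ) (μ : Fin J → ℕ → ℝ) (j : Fin J) : ℝ :=
  ∑' k : ℕ, prodK η μ j k

/-- Product-form stationary distribution `π` of the Jackson network. -/
def piX {J : ℕ} (η : Fin J → ℝ) (μ : Fin J → ℕ → ℝ) (n : Fin J → ℕ) : ℝ :=
  ∏ j, prodK η μ j (n j) / Cnorm η μ j

/-- Product measure `π̃(D,n) = π̂(D)·π(n)`. -/
def piZ {J : ℕ} (η : Fin J → ℝ) (μ : Fin J → ℕ → ℝ) (A B : Finset (Fin J) → ℝ)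
    (x : Est J) : ℝ :=
  piY A B x.1 * piX η μ x.2

/-- Generator `Q^Z` of the unreliable Jackson network. -/
def QZ {J : ℕ} (lam : ℝ) (μ : Fin J → ℕ → ℝ)
    (r : Finset (Fin J) → Option (Fin J) → Option (Fin J) → ℝ)
    (A B : Finset (Fin J) → ℝ) (f : Est J → ℝ) (x : Est J) : ℝ :=
  (∑ j ∈ x.1ᶜ, lam * r x.1 none (some j) * (f (x.1, x.2 + eV (some j)) - f x))
    + (∑ j ∈ x.1ᶜ, μ j (x.2 j) * r x.1 (some j) none * (f (x.1, x.2 - eV (some j)) - f x))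
    + (∑ j ∈ x.1ᶜ, ∑ i ∈ x.1ᶜ,
        μ j (x.2 j) * r x.1 (some j) (some i) * (f (x.1, x.2 - eV (some j) + eV (some i)) - f x))
    + (∑ H ∈ Finset.univ.filter (fun H => H ⊂ x.1), B x.1 / B H * (f (H, x.2) - f x))
    + ∑ I ∈ Finset.univ.filter (fun I => x.1 ⊂ I), A I / A x.1 * (f (I, x.2) - f x)

/-- Transition-rate matrix `q^Z` of the unreliable Jackson network
(between distinct states; the diagonal is set to `0`). -/
def qZ {J : ℕ} (lam : ℝ) (μ : Fin J → ℕ → ℝ)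
    (r : Finset (Fin J) → Option (Fin J) → Option (Fin J) → ℝ)
    (A B : Finset (Fin J) → ℝ) (x y : Est J) : ℝ :=
  if x = y then 0
  else
    (if y.1 = x.1 then
        ∑ j ∈ x.1ᶜ,
          ((if y.2 = x.2 + eV (some j) then lam * r x.1 none (some j) else 0)
            + (if y.2 + eV (some j) = x.2 then μ j (x.2 j) * r x.1 (some j) none else 0)
            + ∑ i ∈ x.1ᶜ,
                if i ≠ j ∧ y.2 + eV (some j) = x.2 + eV (some i) then
                  μ j (x.2 j) * r x.1 (some j) (some i)
                else 0)
      else 0)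
    + (if y.2 = x.2 then
        (if y.1 ⊂ x.1 then B x.1 / B y.1 else 0) + (if x.1 ⊂ y.1 then A y.1 / A x.1 else 0)
      else 0)

/-- Extension `η^D` of the traffic solution: `η^D_0 = λ`, `η^D_j = η_j`. -/
def etaE {J : ℕ} (lam : ℝ) (η : Fin J → ℝ) : Option (Fin J) → ℝ := fun o => o.elim lam η

/-- Normalised routing-equilibrium vector `ξ^D`. -/
def xiV {J : ℕ} (lam : ℝ) (η : Fin J → ℝ) (D : Finset (Fin J))
    (o : Option (Fin J)) : ℝ :=
  etaE lam η o / ∑ k ∈ ext J D, etaE lam η k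

/-- Spectral gap of a generator on the network state space w.r.t. a measure `m`. -/
def GapZ {J : ℕ} (m : Est J → ℝ) (Q : (Est J → ℝ) → Est J → ℝ) : ℝ :=
  sInf {v : ℝ | ∃ f : Est J → ℝ,
    Summable (fun x => f x * f x * m x) ∧ (∑' x, f x * m x) = 0 ∧
      (∑' x, f x * f x * m x) = 1 ∧ v = ∑' x, f x * -(Q f x) * m x}

/-- Spectral gap of a generator on `2^{J̃}` w.r.t. a probability vector `m`. -/
def GapY {J : ℕ} (m : Finset (Fin J) → ℝ)
    (Q : (Finset (Fin J) → ℝ) → Finset (Fin J) → ℝ) : ℝ :=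
  sInf {v : ℝ | ∃ f : Finset (Fin J) → ℝ,
    (∑ D, m D * f D) = 0 ∧ (∑ D, m D * f D ^ 2) = 1 ∧
      v = -(∑ D, m D * f D * Q f D)}

/-- Merge a vector indexed by `D` with a vector indexed by `J̃∖D`. -/
def merge {J : ℕ} (D : Finset (Fin J)) (a : {j : Fin J // j ∈ D} → ℕ)
    (b : {j : Fin J // j ∉ D} → ℕ) : Fin J → ℕ := fun j =>
  if h : j ∈ D then a ⟨j, h⟩ else b ⟨j, h⟩

/-- Marginal product-form density on a sub-collection of nodes. -/
def piSub {J : ℕ} (η : Fin J → ℝ) (μ : Fin J → ℕ → ℝ) (p : Fin J → Prop)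
    [DecidablePred p] (a : {j : Fin J // p j} → ℕ) : ℝ :=
  ∏ j : {j : Fin J // p j}, prodK η μ j.1 (a j) / Cnorm η μ j.1

/-- Unit vector on a subtype index set. -/
def eS {J : ℕ} {p : Fin J → Prop} (j : {k : Fin J // p k}) :
    {k : Fin J // p k} → ℕ := fun i => if i = j then 1 else 0

/-- Generator of the synthetic subnetwork on the up nodes `J̃∖D`. -/
def QXsub {J : ℕ} (lam : ℝ) (μ : Fin J → ℕ → ℝ)
    (r : Finset (Fin J) → Option (Fin J) → Option (Fin J) → ℝ)
    (D : Finset (Fin J)) (h : ({j : Fin J // j ∉ D} → ℕ) → ℝ)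
    (m : {j : Fin J // j ∉ D} → ℕ) : ℝ :=
  (∑ j : {j : Fin J // j ∉ D}, lam * r D none (some j.1) * (h (m + eS j) - h m))
    + (∑ j : {j : Fin J // j ∉ D}, μ j.1 (m j) * r D (some j.1) none * (h (m - eS j) - h m))
    + ∑ j : {j : Fin J // j ∉ D}, ∑ i : {j : Fin J // j ∉ D},
        μ j.1 (m j) * r D (some j.1) (some i.1) * (h (m - eS j + eS i) - h m)

/-- Transition-rate matrix `q^X` of the (reliable) Jackson network. -/
def qX {J : ℕ} (lam : ℝ) (μ : Fin J → ℕ → ℝ)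
    (r : Option (Fin J) → Option (Fin J) → ℝ) (n m : Fin J → ℕ) : ℝ :=
  if n = m then 0
  else
    ∑ j : Fin J,
      ((if m = n + eV (some j) then lam * r none (some j) else 0)
        + (if m + eV (some j) = n then μ j (n j) * r (some j) none else 0)
        + ∑ i : Fin J,
            if i ≠ j ∧ m + eV (some j) = n + eV (some i) then
              μ j (n j) * r (some j) (some i)
            else 0)

/-- One-step Markov operator `K = Id + ε·Q`. -/
def Kop {J : ℕ} (ε : ℝ) (Q : (Est J → ℝ) → Est J → ℝ) :
    (Est J → ℝ) → Est J → ℝ := fun h x => h x + ε * Q h x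

/-- the breakdown/repair process is reversible with respect to `π̂`:
detailed balance `π̂(D)·q^Y(D,E) = π̂(E)·q^Y(E,D)` holds for all `D, E ⊆ J̃`. -/
theorem breakdown_repair_reversible
    (J : ℕ) (hJ : 1 ≤ J)
    (A B : Finset (Fin J) → ℝ)
    (hApos : ∀ D, 0 < A D) (hBpos : ∀ D, 0 < B D)
    (hA0 : A (∅ : Finset (Fin J)) = 1) (hB0 : B (∅ : Finset (Fin J)) = 1)
    :
    ∀ D E : Finset (Fin J), piY A B D * qY A B D E = piY A B E * qY A B E D := by
  intro D E
  by_cases hED : E = D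
  · subst hED
    rfl
  have hDE : ¬ D = E := fun h => hED h.symm
  have a1 := (hApos D).ne'
  have a2 := (hApos E).ne'
  have b1 := (hBpos D).ne'
  have b2 := (hBpos E).ne'
  unfold qY qY0 piY
  rw [if_neg hED, if_neg hDE]
  by_cases h1 : D ⊂ E
  · have h2 : ¬ E ⊂ D := fun h => (h1.trans h).ne rfl
    rw [if_pos h1, if_neg h2, if_pos h1]
    field_simp
  · by_cases h2 : E ⊂ D
    · rw [if_neg h1, if_pos h2, if_pos h2]
      field_simp
    · rw [if_neg h1, if_neg h2, if_neg h2, if_neg h1]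
      simp

end UnrelNet
end
end

section
/- The product measure π̃(D,n) = π̂(D)π(n) satisfies the global balance equations of the unreliable Jackson network: for every state (E,m) ∈ Ẽ, the sum over all states x ≠ (E,m) of π̃(x)·q^Z(x,(E,m)) equals π̃(E,m) times the sum over all states x ≠ (E,m) of q^Z((E,m),x). In particular the product-form measure π̃ is a stationary distribution for the unreliable Jackson network. -/
open scoped BigOperators

noncomputable section

namespace UnrelNet

theorem hs {X : Type*} [DecidableEq X] {P : X → Prop} [DecidablePred P] (c : X) (g : X → ℝ) (v : ℝ)
    (hP : ∀ x, P x → x = c) (hv : P c → g c = v) (hv0 : ¬ P c → v = 0) :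
    HasSum (fun x => if P x then g x else 0) v := by
  have h := hasSum_single (f := fun x => if P x then g x else 0) c (by
    intro b hb
    have : ¬ P b := fun h => hb (hP b h)
    simp [this])
  by_cases hc : P c
  · simpa [hc, hv hc] using h
  · simpa [hc, hv0 hc] using h

theorem eV_self {J : ℕ} (j : Fin J) : eV (some j) j = 1 := by simp [eV]

theorem eV_ne {J : ℕ} {i j : Fin J} (h : i ≠ j) : eV (some j) i = 0 := by simp [eV, h]

theorem sub_add_eV {J : ℕ} (m : Fin J → ℕ) (j : Fin J) (h : m j ≠ 0) :
    m - eV (some j) + eV (some j) = m := by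
  funext i
  by_cases hi : i = j
  · subst hi; simp [eV]; omega
  · simp [eV, hi]

theorem piX_add {J : ℕ} (η : Fin J → ℝ) (μ : Fin J → ℕ → ℝ)
    (hμpos : ∀ j k, k ≠ 0 → 0 < μ j k) (n : Fin J → ℕ) (j : Fin J) :
    piX η μ (n + eV (some j)) * μ j (n j + 1) = η j * piX η μ n := by
  unfold piX
  rw [← Finset.mul_prod_erase _ _ (Finset.mem_univ j),
    ← Finset.mul_prod_erase (a := j) Finset.univ (fun j => prodK η μ j (n j) / Cnorm η μ j)
      (Finset.mem_univ j)]
  have h1 : ∏ x ∈ Finset.univ.erase j, prodK η μ x ((n + eV (some j)) x) / Cnorm η μ x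
      = ∏ x ∈ Finset.univ.erase j, prodK η μ x (n x) / Cnorm η μ x := by
    apply Finset.prod_congr rfl
    intro x hx
    simp [eV, Finset.ne_of_mem_erase hx]
  rw [h1]
  have h2 : prodK η μ j ((n + eV (some j)) j) = prodK η μ j (n j) * (η j / μ j (n j + 1)) := by
    simp only [Pi.add_apply, eV_self, prodK, Finset.prod_range_succ]
  rw [h2]
  have := (hμpos j (n j + 1) (by omega)).ne'
  field_simp

theorem piX_sub {J : ℕ} (η : Fin J → ℝ) (hη : ∀ j, 0 < η j) (μ : Fin J → ℕ → ℝ)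
    (hμpos : ∀ j k, k ≠ 0 → 0 < μ j k) (m : Fin J → ℕ) (j : Fin J) (h : m j ≠ 0) :
    piX η μ (m - eV (some j)) = piX η μ m * (μ j (m j) / η j) := by
  have h1 := piX_add η μ hμpos (m - eV (some j)) j
  rw [sub_add_eV m j h] at h1
  have h2 : (m - eV (some j)) j + 1 = m j := by simp [eV]; omega
  rw [h2] at h1
  have := (hη j).ne'
  field_simp
  linarith

theorem qZ_eq {J : ℕ} (lam : ℝ) (μ : Fin J → ℕ → ℝ)
    (r : Finset (Fin J) → Option (Fin J) → Option (Fin J) → ℝ)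
    (A B : Finset (Fin J) → ℝ) (x y : Est J) : qZ lam μ r A B x y =
    (if y.1 = x.1 then
        ∑ j ∈ x.1ᶜ,
          ((if y.2 = x.2 + eV (some j) then lam * r x.1 none (some j) else 0)
            + (if y.2 + eV (some j) = x.2 then μ j (x.2 j) * r x.1 (some j) none else 0)
            + ∑ i ∈ x.1ᶜ,
                if i ≠ j ∧ y.2 + eV (some j) = x.2 + eV (some i) then
                  μ j (x.2 j) * r x.1 (some j) (some i)
                else 0)
      else 0)
    + (if y.2 = x.2 then
        (if y.1 ⊂ x.1 then B x.1 / B y.1 else 0) + (if x.1 ⊂ y.1 then A y.1 / A x.1 else 0)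
      else 0) := by
  unfold qZ
  split_ifs with h h2 h3
  all_goals first | rfl | skip
  all_goals subst h
  all_goals try simp at *
  symm
  apply Finset.sum_eq_zero
  intro j hj
  have h0 : eV (some j) ≠ 0 := fun h => by
    have := congrFun h j
    simp [eV] at this
  simp only [h0, if_false, zero_add]
  apply Finset.sum_eq_zero
  intro i hi
  rw [if_neg]
  rintro ⟨hij, he⟩
  have := congrFun he j
  simp [eV, Ne.symm hij] at this

theorem tsum_sub {X : Type*} (y : X) (f : X → ℝ) (hf : f y = 0) :
    ∑' x : {x : X // x ≠ y}, f x.1 = ∑' x, f x := by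
  apply tsum_subtype_eq_of_support_subset (s := {x | x ≠ y})
  intro x hx h
  exact hx (h ▸ hf)

theorem hasSum_fin {J : ℕ} (m : Fin J → ℕ) (g : Finset (Fin J) → ℝ) :
    HasSum (fun x : Est J => if m = x.2 then g x.1 else 0) (∑ D, g D) := by
  have h : HasSum (fun x : Est J => ∑ D, if x = (D, m) then g x.1 else 0) (∑ D, g D) := by
    apply hasSum_sum
    intro D _
    apply hs (D, m)
    · intro x h; exact h
    · intro _; rfl
    · intro h; exact absurd rfl h
  convert h using 2 with x
  obtain ⟨D, n⟩ := x
  by_cases hn : m = n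
  · subst hn; simp
  · have : n ≠ m := fun h => hn h.symm
    simp [hn, this]

theorem hasSum_in {J : ℕ} (lam : ℝ) (μ : Fin J → ℕ → ℝ)
    (hμ0 : ∀ j, μ j 0 = 0)
    (hμpos : ∀ j k, k ≠ 0 → 0 < μ j k)
    (r : Finset (Fin J) → Option (Fin J) → Option (Fin J) → ℝ)
    (η : Fin J → ℝ) (hη : ∀ j, 0 < η j)
    (A B : Finset (Fin J) → ℝ) (E : Finset (Fin J)) (m : Fin J → ℕ) :
    HasSum (fun x : Est J => piZ η μ A B x * qZ lam μ r A B x (E, m))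
      ((∑ j ∈ Eᶜ, (piY A B E * piX η μ m * (μ j (m j) / η j) * (lam * r E none (some j))
        + piY A B E * piX η μ m * (η j * r E (some j) none)
        + ∑ i ∈ Eᶜ, if i ≠ j then
            piY A B E * piX η μ m * (μ i (m i) / η i) * (η j * r E (some j) (some i)) else 0))
       + ∑ D, piY A B D * piX η μ m *
          ((if E ⊂ D then B D / B E else 0) + (if D ⊂ E then A E / A D else 0))) := by
  have key : HasSum (fun x : Est J =>
      (∑ j ∈ Eᶜ,
        ((if E = x.1 ∧ m = x.2 + eV (some j) then
            piZ η μ A B x * (lam * r E none (some j)) else 0)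
          + (if E = x.1 ∧ m + eV (some j) = x.2 then
            piZ η μ A B x * (μ j (x.2 j) * r E (some j) none) else 0)
          + ∑ i ∈ Eᶜ, if E = x.1 ∧ i ≠ j ∧ m + eV (some j) = x.2 + eV (some i) then
              piZ η μ A B x * (μ j (x.2 j) * r E (some j) (some i)) else 0))
      + if m = x.2 then piY A B x.1 * piX η μ m *
          ((if E ⊂ x.1 then B x.1 / B E else 0) + (if x.1 ⊂ E then A E / A x.1 else 0)) else 0)
      ((∑ j ∈ Eᶜ, (piY A B E * piX η μ m * (μ j (m j) / η j) * (lam * r E none (some j))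
        + piY A B E * piX η μ m * (η j * r E (some j) none)
        + ∑ i ∈ Eᶜ, if i ≠ j then
            piY A B E * piX η μ m * (μ i (m i) / η i) * (η j * r E (some j) (some i)) else 0))
       + ∑ D, piY A B D * piX η μ m *
          ((if E ⊂ D then B D / B E else 0) + (if D ⊂ E then A E / A D else 0))) := by
    apply HasSum.add
    · apply hasSum_sum
      intro j _
      apply HasSum.add
      apply HasSum.add
      · apply hs (E, m - eV (some j))
        · rintro ⟨D, n⟩ ⟨h1, h2⟩
          simp only at h1 h2
          subst h1 h2
          simp
        · rintro ⟨_, h2⟩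
          have hm : m j ≠ 0 := by
            intro h0
            have := congrFun h2 j
            simp [eV] at this
            omega
          simp only [piZ]
          rw [piX_sub η hη μ hμpos m j hm]
          ring
        · intro h
          have hm : m j = 0 := by
            by_contra h0
            exact h ⟨rfl, (sub_add_eV m j h0).symm⟩
          simp [hm, hμ0]
      · apply hs (E, m + eV (some j))
        · rintro ⟨D, n⟩ ⟨h1, h2⟩
          simp only at h1 h2
          subst h1 h2
          simp
        · intro _
          have := piX_add η μ hμpos m j
          simp only [piZ, Pi.add_apply, eV_self]
          linear_combination piY A B E * r E (some j) none * this
        · intro h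
          exact absurd ⟨rfl, rfl⟩ h
      · apply hasSum_sum
        intro i _
        by_cases hij : i = j
        · subst hij
          simpa using hasSum_zero
        simp only [if_pos (show i ≠ j from hij)]
        apply hs (E, m - eV (some i) + eV (some j))
        · rintro ⟨D, n⟩ ⟨h1, _, h2⟩
          simp only at h1 h2
          subst h1
          congr 1
          funext k
          have := congrFun h2 k
          have h3 := congrFun h2 i
          simp only [Pi.add_apply, Pi.sub_apply, eV] at this h3 ⊢
          rw [if_neg hij] at h3
          by_cases hk : k = i
          · subst hk
            simp [hij] at this h3 ⊢
            omega
          · simp [hk] at this ⊢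
            omega
        · rintro ⟨_, _, h2⟩
          have hm : m i ≠ 0 := by
            intro h0
            have := congrFun h2 i
            simp [eV, hij] at this
            omega
          have h3 := piX_add η μ hμpos (m - eV (some i)) j
          rw [piX_sub η hη μ hμpos m i hm] at h3
          simp only [piZ, Pi.add_apply, eV_self] at h3 ⊢
          linear_combination piY A B E * r E (some j) (some i) * h3
        · intro h
          have hm : m i = 0 := by
            by_contra h0
            refine h ⟨rfl, hij, ?_⟩
            simp only
            rw [add_right_comm, sub_add_eV m i h0]
          simp [hm, hμ0]
    · exact hasSum_fin m (fun D => piY A B D * piX η μ m *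
          ((if E ⊂ D then B D / B E else 0) + (if D ⊂ E then A E / A D else 0)))
  convert key using 2 with x
  obtain ⟨D, n⟩ := x
  rw [qZ_eq, mul_add]
  simp only
  congr 1
  · by_cases h : E = D
    · subst h
      simp only [if_true, true_and, Finset.mul_sum, mul_add, mul_ite, mul_zero]
    · simp [h]
  · by_cases h : m = n
    · subst h
      simp only [if_true, piZ]
    · simp [h]

theorem hasSum_out {J : ℕ} (lam : ℝ) (μ : Fin J → ℕ → ℝ)
    (hμ0 : ∀ j, μ j 0 = 0)
    (r : Finset (Fin J) → Option (Fin J) → Option (Fin J) → ℝ)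
    (A B : Finset (Fin J) → ℝ) (E : Finset (Fin J)) (m : Fin J → ℕ) :
    HasSum (fun x : Est J => qZ lam μ r A B (E, m) x)
      ((∑ j ∈ Eᶜ, (lam * r E none (some j)
        + μ j (m j) * r E (some j) none
        + ∑ i ∈ Eᶜ, if i ≠ j then μ j (m j) * r E (some j) (some i) else 0))
       + ∑ D, ((if D ⊂ E then B E / B D else 0) + (if E ⊂ D then A D / A E else 0))) := by
  have key : HasSum (fun x : Est J =>
      (∑ j ∈ Eᶜ,
        ((if E = x.1 ∧ x.2 = m + eV (some j) then lam * r E none (some j) else 0)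
          + (if E = x.1 ∧ x.2 + eV (some j) = m then μ j (m j) * r E (some j) none else 0)
          + ∑ i ∈ Eᶜ, if E = x.1 ∧ i ≠ j ∧ x.2 + eV (some j) = m + eV (some i) then
              μ j (m j) * r E (some j) (some i) else 0))
      + if m = x.2 then
          ((if x.1 ⊂ E then B E / B x.1 else 0) + (if E ⊂ x.1 then A x.1 / A E else 0)) else 0)
      ((∑ j ∈ Eᶜ, (lam * r E none (some j)
        + μ j (m j) * r E (some j) none
        + ∑ i ∈ Eᶜ, if i ≠ j then μ j (m j) * r E (some j) (some i) else 0))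
       + ∑ D, ((if D ⊂ E then B E / B D else 0) + (if E ⊂ D then A D / A E else 0))) := by
    apply HasSum.add
    · apply hasSum_sum
      intro j _
      apply HasSum.add
      apply HasSum.add
      · apply hs (E, m + eV (some j))
        · rintro ⟨D, n⟩ ⟨h1, h2⟩
          simp only at h1 h2
          subst h1 h2
          simp
        · intro _
          rfl
        · intro h
          exact absurd ⟨rfl, rfl⟩ h
      · apply hs (E, m - eV (some j))
        · rintro ⟨D, n⟩ ⟨h1, h2⟩
          simp only at h1 h2
          subst h1 h2
          simp
        · intro _
          rfl
        · intro h
          have hm : m j = 0 := by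
            by_contra h0
            exact h ⟨rfl, (sub_add_eV m j h0)⟩
          simp [hm, hμ0]
      · apply hasSum_sum
        intro i _
        by_cases hij : i = j
        · subst hij
          simpa using hasSum_zero
        simp only [if_pos (show i ≠ j from hij)]
        apply hs (E, m - eV (some j) + eV (some i))
        · rintro ⟨D, n⟩ ⟨h1, _, h2⟩
          simp only at h1 h2
          subst h1
          congr 1
          have hji : j ≠ i := fun h => hij h.symm
          funext k
          have := congrFun h2 k
          have h3 := congrFun h2 j
          simp only [Pi.add_apply, Pi.sub_apply, eV] at this h3 ⊢
          rw [if_neg hji] at h3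
          by_cases hk : k = j
          · subst hk
            simp [hji] at this h3 ⊢
            omega
          · simp [hk] at this ⊢
            omega
        · intro _
          rfl
        · intro h
          have hm : m j = 0 := by
            by_contra h0
            refine h ⟨rfl, hij, ?_⟩
            simp only
            rw [add_right_comm, sub_add_eV m j h0]
          simp [hm, hμ0]
    · exact hasSum_fin m (fun D =>
          ((if D ⊂ E then B E / B D else 0) + (if E ⊂ D then A D / A E else 0)))
  convert key using 2 with x
  obtain ⟨D, n⟩ := x
  rw [qZ_eq]
  simp only
  congr 1
  · by_cases h : E = D
    · subst h
      simp
    · have h' : D ≠ E := fun h' => h h'.symm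
      simp [h, h']
  · by_cases h : m = n
    · subst h
      simp only [if_true]
    · have h' : n ≠ m := fun h' => h h'.symm
      simp [h, h']

theorem sum_ext {J : ℕ} (D : Finset (Fin J)) (f : Option (Fin J) → ℝ) :
    ∑ j ∈ ext J D, f j = f none + ∑ j ∈ Dᶜ, f (some j) := by
  unfold ext
  rw [Finset.sum_insert (by simp), Finset.sum_image (by simp)]

theorem sum_ne {J : ℕ} (s : Finset (Fin J)) (j : Fin J) (hj : j ∈ s) (f : Fin J → ℝ) :
    (∑ i ∈ s, if i ≠ j then f i else 0) = (∑ i ∈ s, f i) - f j := by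
  have : (∑ i ∈ s, if i ≠ j then f i else 0) + (∑ i ∈ s, if i = j then f i else 0)
      = ∑ i ∈ s, f i := by
    rw [← Finset.sum_add_distrib]
    apply Finset.sum_congr rfl
    intro i _
    by_cases h : i = j <;> simp [h]
  rw [Finset.sum_ite_eq' s j f, if_pos hj] at this
  linarith

/-- the product measure `π̃(D,n) = π̂(D)π(n)` satisfies the global
balance equations of the unreliable Jackson network; in particular it is a
stationary distribution. -/
theorem product_form_global_balance
    (J : ℕ) (hJ : 1 ≤ J)
    (lam : ℝ) (hlam : 0 < lam)
    (μ : Fin J → ℕ → ℝ)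
    (hμ0 : ∀ j, μ j 0 = 0)
    (hμpos : ∀ j k, k ≠ 0 → 0 < μ j k)
    (hμbdd : ∃ M : ℝ, ∀ j k, μ j k ≤ M)
    (r : Finset (Fin J) → Option (Fin J) → Option (Fin J) → ℝ)
    (hrnn : ∀ D : Finset (Fin J), ∀ i ∈ ext J D, ∀ j ∈ ext J D, 0 ≤ r D i j)
    (hrsto : ∀ D : Finset (Fin J), ∀ i ∈ ext J D, ∑ j ∈ ext J D, r D i j = 1)
    (η : Fin J → ℝ) (hη : ∀ j, 0 < η j)
    (htraffic : ∀ D : Finset (Fin J), ∀ j ∈ Dᶜ,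
      η j = lam * r D none (some j) + ∑ i ∈ Dᶜ, η i * r D (some i) (some j))
    (A B : Finset (Fin J) → ℝ)
    (hApos : ∀ D, 0 < A D) (hBpos : ∀ D, 0 < B D)
    (hA0 : A (∅ : Finset (Fin J)) = 1) (hB0 : B (∅ : Finset (Fin J)) = 1)
    (hC : ∀ j, Summable (fun k => prodK η μ j k))
    :
    ∀ y : Est J,
      (∑' x : {x : Est J // x ≠ y}, piZ η μ A B x.1 * qZ lam μ r A B x.1 y)
        = piZ η μ A B y * ∑' x : {x : Est J // x ≠ y}, qZ lam μ r A B y x.1 := by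
  rintro ⟨E, m⟩
  have hz : qZ lam μ r A B (E, m) (E, m) = 0 := by simp [qZ]
  rw [tsum_sub (E, m) (fun x => piZ η μ A B x * qZ lam μ r A B x (E, m)) (by simp [hz]),
    tsum_sub (E, m) (fun x => qZ lam μ r A B (E, m) x) hz,
    (hasSum_in lam μ hμ0 hμpos r η hη A B E m).tsum_eq, (hasSum_out lam μ hμ0 r A B E m).tsum_eq,
    mul_add]
  simp only [piZ]
  congr 1
  · have hst : ∀ j ∈ Eᶜ, ∑ i ∈ Eᶜ, r E (some j) (some i) = 1 - r E (some j) none := by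
      intro j hj
      have h := hrsto E (some j) (by
        rw [ext]; exact Finset.mem_insert_of_mem (Finset.mem_image_of_mem _ hj))
      rw [sum_ext] at h
      linarith
    have hflow : ∑ j ∈ Eᶜ, η j * r E (some j) none = ∑ j ∈ Eᶜ, lam * r E none (some j) := by
      have h1 : ∑ j ∈ Eᶜ, η j = ∑ j ∈ Eᶜ, lam * r E none (some j)
          + ∑ j ∈ Eᶜ, ∑ i ∈ Eᶜ, η i * r E (some i) (some j) := by
        rw [← Finset.sum_add_distrib]
        exact Finset.sum_congr rfl (htraffic E)
      rw [Finset.sum_comm] at h1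
      have h2 : ∑ i ∈ Eᶜ, ∑ j ∈ Eᶜ, η i * r E (some i) (some j)
          = ∑ i ∈ Eᶜ, (η i - η i * r E (some i) none) := by
        apply Finset.sum_congr rfl
        intro i hi
        rw [← Finset.mul_sum, hst i hi]
        ring
      rw [h2, Finset.sum_sub_distrib] at h1
      linarith
    have hin : ∑ j ∈ Eᶜ, ∑ i ∈ Eᶜ, (if i ≠ j then
          piY A B E * piX η μ m * (μ i (m i) / η i) * (η j * r E (some j) (some i)) else 0)
        = ∑ i ∈ Eᶜ, piY A B E * piX η μ m * (μ i (m i) / η i) *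
          (η i - lam * r E none (some i) - η i * r E (some i) (some i)) := by
      rw [Finset.sum_comm]
      apply Finset.sum_congr rfl
      intro i hi
      have h1 := sum_ne Eᶜ i hi (fun j => η j * r E (some j) (some i))
      have h2 := htraffic E i hi
      have h3 : η i - lam * r E none (some i) - η i * r E (some i) (some i)
          = ∑ j ∈ Eᶜ, if j ≠ i then η j * r E (some j) (some i) else 0 := by
        rw [h1]; linarith
      rw [h3, Finset.mul_sum]
      apply Finset.sum_congr rfl
      intro j _
      by_cases h : i = j
      · simp [h]
      · simp [h, Ne.symm h]
    have hout : ∀ j ∈ Eᶜ, (∑ i ∈ Eᶜ, if i ≠ j then μ j (m j) * r E (some j) (some i) else 0)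
        = μ j (m j) * (1 - r E (some j) none - r E (some j) (some j)) := by
      intro j hj
      rw [sum_ne Eᶜ j hj (fun i => μ j (m j) * r E (some j) (some i)), ← Finset.mul_sum, hst j hj]
      ring
    rw [Finset.sum_add_distrib, Finset.sum_add_distrib, hin, ← Finset.mul_sum Eᶜ
      (fun j => η j * r E (some j) none), hflow, Finset.sum_add_distrib, Finset.sum_add_distrib,
      Finset.sum_congr rfl hout, mul_add, mul_add]
    have hfin : ∑ j ∈ Eᶜ, piY A B E * piX η μ m * (μ j (m j) / η j) * (lam * r E none (some j))
        + ∑ i ∈ Eᶜ, piY A B E * piX η μ m * (μ i (m i) / η i) *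
          (η i - lam * r E none (some i) - η i * r E (some i) (some i))
        = piY A B E * piX η μ m * ∑ j ∈ Eᶜ, μ j (m j) * r E (some j) none
        + piY A B E * piX η μ m * ∑ j ∈ Eᶜ,
          μ j (m j) * (1 - r E (some j) none - r E (some j) (some j)) := by
      rw [Finset.mul_sum, Finset.mul_sum, ← Finset.sum_add_distrib, ← Finset.sum_add_distrib]
      apply Finset.sum_congr rfl
      intro j _
      have := (hη j).ne'
      field_simp
      ring
    linarith
  · rw [Finset.mul_sum]
    apply Finset.sum_congr rfl
    intro D _
    have a1 := (hApos D).ne'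
    have a2 := (hApos E).ne'
    have b1 := (hBpos D).ne'
    have b2 := (hBpos E).ne'
    have e1 : piY A B D * (B D / B E) = piY A B E * (A D / A E) := by
      unfold piY; field_simp
    have e2 : piY A B D * (A E / A D) = piY A B E * (B E / B D) := by
      unfold piY; field_simp
    by_cases h1 : E ⊂ D
    · have h2 : ¬ D ⊂ E := fun h => (h1.trans h).ne rfl
      simp only [h1, h2, if_true, if_false]
      linear_combination piX η μ m * e1
    · by_cases h2 : D ⊂ E
      · simp only [h1, h2, if_true, if_false]
        linear_combination piX η μ m * e2
      · simp [h1, h2]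


end UnrelNet
end
end

section
/- Splitting formula: for all square-summable f, g : Ẽ → ℝ, ⟨f, Q^Z g⟩_π̃ = Σ_{n∈ℕ^{J̃}} π(n) Σ_{D⊆J̃} π̂(D) f(D,n)·(Q^Y g(·,n))(D) + Σ_{D⊆J̃} π̂(D) Σ_{n_D∈ℕ^{D}} π_D(n_D) Σ_{m∈ℕ^{J̃∖D}} π_{J̃∖D}(m) f(D,(n_D,m))·(Q^{X_{J̃∖D}} g(D,(n_D,·)))(m), all series converging absolutely. -/
open scoped BigOperators

noncomputable section

namespace UnrelNet

/-- The queueing part of the generator for fixed set `D` of down nodes. -/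
def LX {J : ℕ} (lam : ℝ) (μ : Fin J → ℕ → ℝ)
    (r : Finset (Fin J) → Option (Fin J) → Option (Fin J) → ℝ)
    (D : Finset (Fin J)) (G : (Fin J → ℕ) → ℝ) (n : Fin J → ℕ) : ℝ :=
  (∑ j ∈ Dᶜ, lam * r D none (some j) * (G (n + eV (some j)) - G n))
    + (∑ j ∈ Dᶜ, μ j (n j) * r D (some j) none * (G (n - eV (some j)) - G n))
    + (∑ j ∈ Dᶜ, ∑ i ∈ Dᶜ,
        μ j (n j) * r D (some j) (some i) * (G (n - eV (some j) + eV (some i)) - G n))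

theorem QZ_eq {J : ℕ} (lam : ℝ) (μ : Fin J → ℕ → ℝ)
    (r : Finset (Fin J) → Option (Fin J) → Option (Fin J) → ℝ)
    (A B : Finset (Fin J) → ℝ) (g : Est J → ℝ) (D : Finset (Fin J)) (n : Fin J → ℕ) :
    QZ lam μ r A B g (D, n) =
      LX lam μ r D (fun n => g (D, n)) n + QY A B (fun E => g (E, n)) D := by
  simp only [QZ, LX, QY]; ring

theorem hasSum_fin_prod {α β : Type*} [Fintype α] [DecidableEq α] (h : α × β → ℝ)
    (hs : ∀ a, Summable (fun b => h (a, b))) :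
    HasSum h (∑ a, ∑' b, h (a, b)) := by
  have key : ∀ a ∈ (Finset.univ : Finset α),
      HasSum (fun x : α × β => if x.1 = a then h x else 0) (∑' b, h (a, b)) := by
    intro a _
    have hinj : Function.Injective (fun b : β => (a, b)) := fun b c hbc => by simpa using hbc
    rw [← hinj.hasSum_iff]
    · simpa [Function.comp_def] using (hs a).hasSum
    · rintro ⟨a', b⟩ hx
      have : a' ≠ a := by
        rintro rfl
        exact hx ⟨b, rfl⟩
      simp [this]
  have := hasSum_sum key
  simpa using this

theorem merge_add {J : ℕ} (D : Finset (Fin J)) (a : {j : Fin J // j ∈ D} → ℕ)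
    (b : {j : Fin J // j ∉ D} → ℕ) (j : {j : Fin J // j ∉ D}) :
    merge D a (b + eS j) = merge D a b + eV (some j.1) := by
  funext i
  by_cases h : i ∈ D
  · have : i ≠ j.1 := fun e => j.2 (e ▸ h)
    simp [merge, eV, h, this]
  · simp [merge, eV, eS, h, Subtype.ext_iff]

theorem merge_sub {J : ℕ} (D : Finset (Fin J)) (a : {j : Fin J // j ∈ D} → ℕ)
    (b : {j : Fin J // j ∉ D} → ℕ) (j : {j : Fin J // j ∉ D}) :
    merge D a (b - eS j) = merge D a b - eV (some j.1) := by
  funext i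
  by_cases h : i ∈ D
  · have : i ≠ j.1 := fun e => j.2 (e ▸ h)
    simp [merge, eV, h, this]
  · simp [merge, eV, eS, h, Subtype.ext_iff]

theorem merge_coe {J : ℕ} (D : Finset (Fin J)) (a : {j : Fin J // j ∈ D} → ℕ)
    (b : {j : Fin J // j ∉ D} → ℕ) (j : {j : Fin J // j ∉ D}) :
    merge D a b j.1 = b j := by
  simp [merge, j.2]

theorem QXsub_eq {J : ℕ} (lam : ℝ) (μ : Fin J → ℕ → ℝ)
    (r : Finset (Fin J) → Option (Fin J) → Option (Fin J) → ℝ)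
    (D : Finset (Fin J)) (G : (Fin J → ℕ) → ℝ) (a : {j : Fin J // j ∈ D} → ℕ)
    (b : {j : Fin J // j ∉ D} → ℕ) :
    QXsub lam μ r D (fun b' => G (merge D a b')) b = LX lam μ r D G (merge D a b) := by
  have hs : ∀ φ : Fin J → ℝ, ∑ j ∈ Dᶜ, φ j = ∑ j : {j : Fin J // j ∉ D}, φ j.1 :=
    fun φ => Finset.sum_subtype Dᶜ (by simp) φ
  simp only [QXsub, LX, hs, merge_add, merge_sub, merge_coe]

theorem piX_merge {J : ℕ} (η : Fin J → ℝ) (μ : Fin J → ℕ → ℝ)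
    (D : Finset (Fin J)) (a : {j : Fin J // j ∈ D} → ℕ) (b : {j : Fin J // j ∉ D} → ℕ) :
    piX η μ (merge D a b) = piSub η μ (· ∈ D) a * piSub η μ (· ∉ D) b := by
  unfold piX piSub
  rw [← Fintype.prod_subtype_mul_prod_subtype (· ∈ D)]
  congr 1
  · exact Finset.prod_congr rfl fun j _ => by simp [merge, j.2]
  · exact Finset.prod_congr rfl fun j _ => by simp [merge, j.2]

/-- Splitting a vector along `D`. -/
def mergeEquiv {J : ℕ} (D : Finset (Fin J)) :
    ({j : Fin J // j ∈ D} → ℕ) × ({j : Fin J // j ∉ D} → ℕ) ≃ (Fin J → ℕ) where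
  toFun q := merge D q.1 q.2
  invFun n := (fun j => n j.1, fun j => n j.1)
  left_inv q := by
    ext j
    · simp [merge, j.2]
    · simp [merge, j.2]
  right_inv n := by
    funext j
    simp [merge]

theorem eV_inj {J : ℕ} (j : Fin J) : Function.Injective (fun n : Fin J → ℕ => n + eV (some j)) :=
  fun _ _ h => add_right_cancel h

theorem prodK_nonneg {J : ℕ} {η : Fin J → ℝ} {μ : Fin J → ℕ → ℝ} (hη : ∀ j, 0 < η j)
    (hμpos : ∀ j k, k ≠ 0 → 0 < μ j k) (j : Fin J) (k : ℕ) : 0 < prodK η μ j k :=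
  Finset.prod_pos fun i _ => div_pos (hη j) (hμpos j _ (by omega))

theorem piX_nonneg {J : ℕ} {η : Fin J → ℝ} {μ : Fin J → ℕ → ℝ} (hη : ∀ j, 0 < η j)
    (hμpos : ∀ j k, k ≠ 0 → 0 < μ j k) (n : Fin J → ℕ) : 0 ≤ piX η μ n :=
  Finset.prod_nonneg fun j _ => div_nonneg (prodK_nonneg hη hμpos j _).le
    (tsum_nonneg fun k => (prodK_nonneg hη hμpos j k).le)

theorem piX_shift {J : ℕ} {η : Fin J → ℝ} {μ : Fin J → ℕ → ℝ}
    (hμpos : ∀ j k, k ≠ 0 → 0 < μ j k) (n : Fin J → ℕ) (j : Fin J) :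
    μ j (n j + 1) * piX η μ (n + eV (some j)) = η j * piX η μ n := by
  unfold piX
  rw [← Finset.mul_prod_erase Finset.univ _ (Finset.mem_univ j),
    ← Finset.mul_prod_erase Finset.univ (fun i => prodK η μ i (n i) / _) (Finset.mem_univ j)]
  have h1 : ∏ x ∈ Finset.univ.erase j, prodK η μ x ((n + eV (some j)) x) / Cnorm η μ x
      = ∏ x ∈ Finset.univ.erase j, prodK η μ x (n x) / Cnorm η μ x := by
    refine Finset.prod_congr rfl fun x hx => ?_
    have : x ≠ j := Finset.ne_of_mem_erase hx
    simp [eV, this]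
  rw [h1]
  have h2 : (n + eV (some j)) j = n j + 1 := by simp [eV]
  rw [h2]
  have h3 : μ j (n j + 1) * prodK η μ j (n j + 1) = η j * prodK η μ j (n j) := by
    have := (hμpos j (n j + 1) (by omega)).ne'
    unfold prodK
    rw [Finset.prod_range_succ]
    field_simp
  linear_combination (∏ x ∈ Finset.univ.erase j, prodK η μ x (n x) / Cnorm η μ x) *
    (Cnorm η μ j)⁻¹ * h3

theorem summable_cs {α : Type*} {p F G : α → ℝ} (hp : ∀ x, 0 ≤ p x)
    (hF : Summable fun x => F x * F x * p x) (hG : Summable fun x => G x * G x * p x) :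
    Summable fun x => F x * G x * p x := by
  refine Summable.of_norm_bounded (hF.add hG) fun x => ?_
  rw [Real.norm_eq_abs, abs_mul, abs_of_nonneg (hp x), ← add_mul]
  refine mul_le_mul_of_nonneg_right ?_ (hp x)
  rw [abs_le]
  constructor <;> nlinarith [sq_nonneg (F x + G x), sq_nonneg (F x - G x), sq_nonneg (F x), sq_nonneg (G x)]

theorem summable_LX {J : ℕ} (lam : ℝ) {η : Fin J → ℝ} {μ : Fin J → ℕ → ℝ} (hη : ∀ j, 0 < η j)
    (hμ0 : ∀ j, μ j 0 = 0)
    (hμpos : ∀ j k, k ≠ 0 → 0 < μ j k)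
    (hμbdd : ∃ M : ℝ, ∀ j k, μ j k ≤ M)
    (r : Finset (Fin J) → Option (Fin J) → Option (Fin J) → ℝ)
    (D : Finset (Fin J)) {F G : (Fin J → ℕ) → ℝ}
    (hF : Summable fun n => F n * F n * piX η μ n)
    (hG : Summable fun n => G n * G n * piX η μ n) :
    Summable fun n => F n * LX lam μ r D G n * piX η μ n := by
  obtain ⟨M, hM⟩ := hμbdd
  have hp := piX_nonneg hη hμpos
  have hshift : ∀ (F : (Fin J → ℕ) → ℝ) (j : Fin J), (Summable fun n => F n * F n * piX η μ n) →
      Summable fun n => F (n + eV (some j)) * F (n + eV (some j)) * piX η μ n := by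
    intro F j hF
    refine Summable.of_nonneg_of_le (fun n => mul_nonneg (mul_self_nonneg _) (hp n)) (fun n => ?_)
      ((hF.comp_injective (eV_inj j)).mul_left (M / η j))
    have h1 := piX_shift (η := η) hμpos n j
    have h2 : piX η μ n ≤ M / η j * piX η μ (n + eV (some j)) := by
      rw [div_mul_eq_mul_div, le_div_iff₀ (hη j), mul_comm, ← h1]
      exact mul_le_mul_of_nonneg_right (hM _ _) (hp _)
    calc _ ≤ F (n + eV (some j)) * F (n + eV (some j)) * (M / η j * piX η μ (n + eV (some j))) :=
          mul_le_mul_of_nonneg_left h2 (mul_self_nonneg _)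
      _ = _ := by simp only [Function.comp]; ring
  -- departures reduce to sums over the shifted state
  have hdep : ∀ (j : Fin J) (K : (Fin J → ℕ) → ℝ),
      (Summable fun n => F (n + eV (some j)) * K (n + eV (some j)) * piX η μ n) →
      Summable fun n => F n * (μ j (n j) * K n) * piX η μ n := by
    intro j K hK
    rw [← (eV_inj j).summable_iff]
    · refine (hK.mul_left (η j)).congr fun n => ?_
      have h1 := piX_shift (η := η) hμpos n j
      have h2 : (n + eV (some j)) j = n j + 1 := by simp [eV]
      simp only [Function.comp, h2]
      linear_combination (-F (n + eV (some j)) * K (n + eV (some j))) * h1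
    · intro n hn
      have : n j = 0 := by
        by_contra h
        refine hn ⟨n - eV (some j), ?_⟩
        funext i
        by_cases hi : i = j
        · subst hi
          simp [eV]; omega
        · simp [eV, hi]
      simp [this, hμ0]
  have hcan : ∀ (n : Fin J → ℕ) (j : Fin J), n + eV (some j) - eV (some j) = n := by
    intro n j; funext i; simp
  have S1 : ∀ j, Summable fun n =>
      F n * (lam * r D none (some j) * (G (n + eV (some j)) - G n)) * piX η μ n := by
    intro j
    refine (((summable_cs hp hF (hshift G j hG)).sub (summable_cs hp hF hG)).mul_left
      (lam * r D none (some j))).congr fun n => ?_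
    ring
  have S2 : ∀ j, Summable fun n =>
      F n * (μ j (n j) * r D (some j) none * (G (n - eV (some j)) - G n)) * piX η μ n := by
    intro j
    have := hdep j (fun n => r D (some j) none * (G (n - eV (some j)) - G n)) ?_
    · refine this.congr fun n => ?_
      ring
    · refine (((summable_cs hp (hshift F j hF) hG).sub
        (summable_cs hp (hshift F j hF) (hshift G j hG))).mul_left
        (r D (some j) none)).congr fun n => ?_
      rw [hcan]; ring
  have S3 : ∀ j i, Summable fun n =>
      F n * (μ j (n j) * r D (some j) (some i) *
        (G (n - eV (some j) + eV (some i)) - G n)) * piX η μ n := by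
    intro j i
    have := hdep j (fun n => r D (some j) (some i) *
      (G (n - eV (some j) + eV (some i)) - G n)) ?_
    · refine this.congr fun n => ?_
      ring
    · refine (((summable_cs hp (hshift F j hF) (hshift G i hG)).sub
        (summable_cs hp (hshift F j hF) (hshift G j hG))).mul_left
        (r D (some j) (some i))).congr fun n => ?_
      rw [hcan]; ring
  have T1 := summable_sum (s := Dᶜ) fun j _ => S1 j
  have T2 := summable_sum (s := Dᶜ) fun j _ => S2 j
  have T3 := summable_sum (s := Dᶜ) fun j _ => summable_sum (s := Dᶜ) fun i _ => S3 j i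
  refine ((T1.add T2).add T3).congr fun n => ?_
  simp only [LX, mul_add, add_mul, Finset.mul_sum, Finset.sum_mul]

/-- splitting formula for the one-step correlation
`⟨f, Q^Z g⟩_π̃`, all series converging absolutely. -/
theorem splitting_formula
    (J : ℕ) (hJ : 1 ≤ J)
    (lam : ℝ) (hlam : 0 < lam)
    (μ : Fin J → ℕ → ℝ)
    (hμ0 : ∀ j, μ j 0 = 0)
    (hμpos : ∀ j k, k ≠ 0 → 0 < μ j k)
    (hμbdd : ∃ M : ℝ, ∀ j k, μ j k ≤ M)
    (r : Finset (Fin J) → Option (Fin J) → Option (Fin J) → ℝ)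
    (hrnn : ∀ D : Finset (Fin J), ∀ i ∈ ext J D, ∀ j ∈ ext J D, 0 ≤ r D i j)
    (hrsto : ∀ D : Finset (Fin J), ∀ i ∈ ext J D, ∑ j ∈ ext J D, r D i j = 1)
    (η : Fin J → ℝ) (hη : ∀ j, 0 < η j)
    (htraffic : ∀ D : Finset (Fin J), ∀ j ∈ Dᶜ,
      η j = lam * r D none (some j) + ∑ i ∈ Dᶜ, η i * r D (some i) (some j))
    (A B : Finset (Fin J) → ℝ)
    (hApos : ∀ D, 0 < A D) (hBpos : ∀ D, 0 < B D)
    (hA0 : A (∅ : Finset (Fin J)) = 1) (hB0 : B (∅ : Finset (Fin J)) = 1)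
    (hC : ∀ j, Summable (fun k => prodK η μ j k))
    (f g : Est J → ℝ)
    (hf : Summable (fun x : Est J => f x * f x * piZ η μ A B x))
    (hg : Summable (fun x : Est J => g x * g x * piZ η μ A B x)) :
    Summable (fun x : Est J => f x * QZ lam μ r A B g x * piZ η μ A B x)
      ∧ Summable (fun n : Fin J → ℕ =>
          piX η μ n * ∑ D : Finset (Fin J),
            piY A B D * f (D, n) * QY A B (fun E => g (E, n)) D)
      ∧ (∀ D : Finset (Fin J),
          Summable (fun q : ({j : Fin J // j ∈ D} → ℕ) × ({j : Fin J // j ∉ D} → ℕ) =>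
            piSub η μ (· ∈ D) q.1 * piSub η μ (· ∉ D) q.2
              * f (D, merge D q.1 q.2)
              * QXsub lam μ r D (fun b' => g (D, merge D q.1 b')) q.2))
      ∧ (∑' x : Est J, f x * QZ lam μ r A B g x * piZ η μ A B x)
          = (∑' n : Fin J → ℕ,
              piX η μ n * ∑ D : Finset (Fin J),
                piY A B D * f (D, n) * QY A B (fun E => g (E, n)) D)
            + ∑ D : Finset (Fin J), piY A B D *
                ∑' a : {j : Fin J // j ∈ D} → ℕ, piSub η μ (· ∈ D) a *
                  ∑' b : {j : Fin J // j ∉ D} → ℕ, piSub η μ (· ∉ D) b *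
                    f (D, merge D a b)
                      * QXsub lam μ r D (fun b' => g (D, merge D a b')) b := by
  have hp := piX_nonneg hη hμpos
  have hchat : 0 < Chat A B :=
    Finset.sum_pos (fun D _ => div_pos (hApos D) (hBpos D)) ⟨∅, Finset.mem_univ _⟩
  have hY : ∀ D, 0 < piY A B D := fun D => div_pos (div_pos (hApos D) (hBpos D)) hchat
  have hsec : ∀ h : Est J → ℝ, (Summable fun x : Est J => h x * h x * piZ η μ A B x) →
      ∀ D, Summable fun n => h (D, n) * h (D, n) * piX η μ n := by
    intro h hh D
    have hinj : Function.Injective (fun n : Fin J → ℕ => ((D, n) : Est J)) :=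
      fun b c hbc => by simpa using hbc
    refine ((hh.comp_injective hinj).mul_left (piY A B D)⁻¹).congr fun n => ?_
    have := (hY D).ne'
    simp only [Function.comp, piZ]
    field_simp
  have hf' := hsec f hf
  have hg' := hsec g hg
  have hL : ∀ D, Summable fun n =>
      f (D, n) * LX lam μ r D (fun n => g (D, n)) n * piX η μ n := fun D =>
    summable_LX lam hη hμ0 hμpos hμbdd r D (hf' D) (hg' D)
  have hQ : ∀ D, Summable fun n =>
      f (D, n) * QY A B (fun E => g (E, n)) D * piX η μ n := by
    intro D
    have hd : ∀ (c : ℝ) (E : Finset (Fin J)), Summable fun n =>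
        f (D, n) * (c * (g (E, n) - g (D, n))) * piX η μ n := by
      intro c E
      refine (((summable_cs hp (hf' D) (hg' E)).sub
        (summable_cs hp (hf' D) (hg' D))).mul_left c).congr fun n => ?_
      ring
    have T1 := summable_sum (s := Finset.univ.filter (fun H => H ⊂ D))
      fun H _ => hd (B D / B H) H
    have T2 := summable_sum (s := Finset.univ.filter (fun I => D ⊂ I))
      fun I _ => hd (A I / A D) I
    refine (T1.add T2).congr fun n => ?_
    simp only [QY, mul_add, add_mul, Finset.mul_sum, Finset.sum_mul]
  have hrow : ∀ D, Summable fun n =>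
      f (D, n) * QZ lam μ r A B g (D, n) * piZ η μ A B (D, n) := by
    intro D
    refine (((hL D).add (hQ D)).mul_left (piY A B D)).congr fun n => ?_
    rw [QZ_eq]; simp only [piZ]; ring
  have hmain := hasSum_fin_prod
    (fun x : Est J => f x * QZ lam μ r A B g x * piZ η μ A B x) hrow
  have hQ' : ∀ D ∈ (Finset.univ : Finset (Finset (Fin J))), Summable fun n =>
      piX η μ n * (piY A B D * f (D, n) * QY A B (fun E => g (E, n)) D) := fun D _ =>
    ((hQ D).mul_left (piY A B D)).congr fun n => by ring
  have hsub : ∀ D : Finset (Fin J),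
      Summable (fun q : ({j : Fin J // j ∈ D} → ℕ) × ({j : Fin J // j ∉ D} → ℕ) =>
            piSub η μ (· ∈ D) q.1 * piSub η μ (· ∉ D) q.2
              * f (D, merge D q.1 q.2)
              * QXsub lam μ r D (fun b' => g (D, merge D q.1 b')) q.2) := by
    intro D
    refine ((mergeEquiv D).summable_iff.mpr (hL D)).congr fun q => ?_
    have h1 := QXsub_eq lam μ r D (fun n => g (D, n)) q.1 q.2
    have h2 := piX_merge η μ D q.1 q.2
    simp only [Function.comp, mergeEquiv, Equiv.coe_fn_mk]
    rw [h1, h2]; ring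
  refine ⟨hmain.summable, ?_, hsub, ?_⟩
  · simp only [Finset.mul_sum]
    exact summable_sum hQ'
  · rw [hmain.tsum_eq]
    simp only [Finset.mul_sum]
    rw [Summable.tsum_finsetSum hQ', ← Finset.sum_add_distrib]
    refine Finset.sum_congr rfl fun D _ => ?_
    have e1 : (∑' a : {j : Fin J // j ∈ D} → ℕ, piSub η μ (· ∈ D) a *
                  ∑' b : {j : Fin J // j ∉ D} → ℕ, piSub η μ (· ∉ D) b *
                    f (D, merge D a b)
                      * QXsub lam μ r D (fun b' => g (D, merge D a b')) b)
        = ∑' n, f (D, n) * LX lam μ r D (fun n => g (D, n)) n * piX η μ n := by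
      rw [← (mergeEquiv D).tsum_eq]
      have h3 := (hsub D).tsum_prod
      have h4 : (∑' q, f (D, mergeEquiv D q) *
            LX lam μ r D (fun n => g (D, n)) (mergeEquiv D q) * piX η μ (mergeEquiv D q))
          = ∑' q : ({j : Fin J // j ∈ D} → ℕ) × ({j : Fin J // j ∉ D} → ℕ),
            piSub η μ (· ∈ D) q.1 * piSub η μ (· ∉ D) q.2
              * f (D, merge D q.1 q.2)
              * QXsub lam μ r D (fun b' => g (D, merge D q.1 b')) q.2 := by
        refine tsum_congr fun q => ?_
        have h1 := QXsub_eq lam μ r D (fun n => g (D, n)) q.1 q.2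
        have h2 := piX_merge η μ D q.1 q.2
        simp only [mergeEquiv, Equiv.coe_fn_mk]
        rw [h1, h2]; ring
      rw [h4, h3]
      refine tsum_congr fun a => ?_
      rw [← tsum_mul_left]
      refine tsum_congr fun b => ?_
      ring
    rw [e1, ← tsum_mul_left, ← (hQ' D (Finset.mem_univ _)).tsum_add ((hL D).mul_left _)]
    refine tsum_congr fun n => ?_
    rw [QZ_eq]; simp only [piZ]; ring

end UnrelNet
end
end
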